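/- arXiv:1509.03748 — 9 statements merged into one kernel-verified Lean document; each statement's English description precedes it below -/
import Mathlib

section
/- Let X be a metric space and let c, d : ℝ → X be 1-Lipschitz maps. Then for all σ, τ ∈ ℝ one has D(Φ_τ(c), Φ_σ(d)) ≤ e^{|τ|} · D(c,d) + |σ − τ|, where D(f,g) = ∫_ℝ d_X(f(t),g(t))/(2e^{|t|}) dt and Φ_τ(f) = f(· + τ). -/
open MeasureTheory

namespace FJ

/-- The metric `D` on `Lip₁(X)`: `D(f,g) = ∫_ℝ d(f t, g t) / (2 e^{|t|}) dt`. -/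
noncomputable def lipDist {X : Type*} [MetricSpace X] (f g : ℝ → X) : ℝ :=
  ∫ t : ℝ, dist (f t) (g t) / (2 * Real.exp |t|)

/-- The shift `Φ_τ(f) = f(· + τ)`. -/
def timeShift {X : Type*} (τ : ℝ) (f : ℝ → X) : ℝ → X := fun t => f (t + τ)

theorem integrable_exp_mul_abs_of_neg {a : ℝ} (ha : a < 0) :
    Integrable fun t : ℝ => Real.exp (a * |t|) := by
  rw [← integrableOn_univ, ← Set.Iic_union_Ioi (a := (0 : ℝ))]
  refine IntegrableOn.union ?_ ?_
  · refine (integrableOn_exp_mul_Iic (neg_pos.mpr ha) 0).congr_fun (fun t ht => ?_)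
      measurableSet_Iic
    simp only [abs_of_nonpos (Set.mem_Iic.mp ht), mul_neg, neg_mul]
  · refine (integrableOn_exp_mul_Ioi ha 0).congr_fun (fun t ht => ?_) measurableSet_Ioi
    simp only [abs_of_pos (Set.mem_Ioi.mp ht)]

theorem integral_exp_neg_abs : ∫ t : ℝ, Real.exp (-|t|) = 2 := by
  rw [integral_comp_abs (f := fun t => Real.exp (-t)), integral_exp_neg_Ioi_zero, mul_one]

theorem integrable_dist_div_exp_abs {X : Type*} [MetricSpace X] {c d : ℝ → X}
    (hc : LipschitzWith 1 c) (hd : LipschitzWith 1 d) :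
    Integrable fun t : ℝ => dist (c t) (d t) / (2 * Real.exp |t|) := by
  have hcont : Continuous fun t : ℝ => dist (c t) (d t) / (2 * Real.exp |t|) :=
    (hc.continuous.dist hd.continuous).div (by fun_prop) fun t => by positivity
  refine ((integrable_exp_mul_abs_of_neg (a := -(1 / 2)) (by norm_num)).const_mul
    (dist (c 0) (d 0) + 4)).mono' hcont.aestronglyMeasurable (.of_forall fun t => ?_)
  have hct := hc.dist_le_mul t 0
  have hdt := hd.dist_le_mul 0 t
  have htri := dist_triangle4 (c t) (c 0) (d 0) (d t)
  simp only [NNReal.coe_one, one_mul, Real.dist_eq, sub_zero, zero_sub, abs_neg] at hct hdt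
  have hsplit : Real.exp |t| = Real.exp (|t| / 2) * Real.exp (|t| / 2) := by
    rw [← Real.exp_add, add_halves]
  have hlin := Real.add_one_le_exp (|t| / 2)
  have hone : 1 ≤ Real.exp (|t| / 2) := Real.one_le_exp (by positivity)
  have hdist : (0 : ℝ) ≤ dist (c 0) (d 0) := dist_nonneg
  rw [Real.norm_of_nonneg (by positivity), div_le_iff₀ (by positivity),
    show -(1 / 2) * |t| = -(|t| / 2) by ring, Real.exp_neg, hsplit]
  field_simp
  nlinarith

/-- For `1`-Lipschitz maps `c d : ℝ → X` and `σ, τ ∈ ℝ` we have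
`D(Φ_τ(c), Φ_σ(d)) ≤ e^{|τ|} · D(c,d) + |σ − τ|`. -/
theorem lipDist_shift_le {X : Type*} [MetricSpace X]
    (c d : ℝ → X) (hc : LipschitzWith 1 c) (hd : LipschitzWith 1 d) (σ τ : ℝ) :
    lipDist (timeShift τ c) (timeShift σ d) ≤ Real.exp |τ| * lipDist c d + |σ - τ| := by
  have hint := ((integrable_dist_div_exp_abs hc hd).comp_add_right τ).const_mul (Real.exp |τ|)
  have hexp : Integrable fun t : ℝ => |σ - τ| / 2 * Real.exp (-|t|) := by
    simpa using (integrable_exp_mul_abs_of_neg (a := -1) (by norm_num)).const_mul (|σ - τ| / 2)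
  calc lipDist (timeShift τ c) (timeShift σ d)
      ≤ ∫ t : ℝ, (Real.exp |τ| * (dist (c (t + τ)) (d (t + τ)) / (2 * Real.exp |t + τ|)) +
          |σ - τ| / 2 * Real.exp (-|t|)) := by
        refine integral_mono_of_nonneg (.of_forall fun t => by positivity) (hint.add hexp)
          (.of_forall fun t => ?_)
        have hdt := hd.dist_le_mul (t + τ) (t + σ)
        have htri := dist_triangle (c (t + τ)) (d (t + τ)) (d (t + σ))
        simp only [NNReal.coe_one, one_mul, Real.dist_eq, add_sub_add_left_eq_sub,
          abs_sub_comm τ σ] at hdt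
        have hweight : Real.exp |t + τ| ≤ Real.exp |τ| * Real.exp |t| := by
          rw [← Real.exp_add, Real.exp_le_exp, add_comm |τ|]
          exact abs_add_le t τ
        have hshift : dist (c (t + τ)) (d (t + τ)) / (2 * Real.exp |t|) ≤
            Real.exp |τ| * (dist (c (t + τ)) (d (t + τ)) / (2 * Real.exp |t + τ|)) := by
          rw [← mul_div_assoc, div_le_div_iff₀ (by positivity) (by positivity)]
          nlinarith [mul_le_mul_of_nonneg_left hweight
            (dist_nonneg (x := c (t + τ)) (y := d (t + τ)))]
        calc dist (c (t + τ)) (d (t + σ)) / (2 * Real.exp |t|)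
            ≤ (dist (c (t + τ)) (d (t + τ)) + |σ - τ|) / (2 * Real.exp |t|) := by
              gcongr
              linarith
          _ = dist (c (t + τ)) (d (t + τ)) / (2 * Real.exp |t|) +
              |σ - τ| / 2 * Real.exp (-|t|) := by
              rw [Real.exp_neg]
              field_simp
          _ ≤ _ := add_le_add_left hshift _
    _ = Real.exp |τ| * lipDist c d + |σ - τ| := by
        rw [integral_add hint hexp, integral_const_mul, integral_const_mul,
          integral_exp_neg_abs, div_mul_cancel₀ _ two_ne_zero,
          integral_add_right_eq_self (fun t => dist (c t) (d t) / (2 * Real.exp |t|)) τ, lipDist]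

end FJ
end

section
/- If X is a proper metric space (all closed bounded subsets are compact), then the space Lip₁(X) of 1-Lipschitz maps ℝ → X, with the metric D(f,g) = ∫_ℝ d_X(f(t),g(t))/(2e^{|t|}) dt, is a proper metric space; that is, every closed ball in (Lip₁(X), D) is compact. -/
open MeasureTheory

namespace FJ

/-- `Lip₁(X)`, the space of `1`-Lipschitz maps `ℝ → X`; its topology (the subspace topology
from the compact-open topology on `C(ℝ, X)`) is the one induced by the metric `D`. -/
def Lip1 (X : Type*) [MetricSpace X] := {f : C(ℝ, X) // LipschitzWith 1 ⇑f}

instance {X : Type*} [MetricSpace X] : TopologicalSpace (Lip1 X) :=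
  instTopologicalSpaceSubtype

lemma continuous_weight : Continuous fun t : ℝ ↦ (2 * Real.exp |t|)⁻¹ :=
  Continuous.inv₀ (by fun_prop) fun t ↦ by positivity

lemma integrable_weight : Integrable fun t : ℝ ↦ (2 * Real.exp |t|)⁻¹ := by
  refine (integrable_inv_one_add_sq.const_mul 3).mono' continuous_weight.aestronglyMeasurable
    (.of_forall fun t ↦ ?_)
  have h := Real.pow_div_factorial_le_exp |t| (abs_nonneg t) 2
  have h0 := Real.add_one_le_exp |t|
  have ht := abs_nonneg t
  norm_num [Nat.factorial] at h
  rw [Real.norm_of_nonneg (by positivity), ← div_eq_mul_inv, inv_eq_one_div,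
    div_le_div_iff₀ (by positivity) (by positivity)]
  linarith

lemma integrable_abs_mul_weight : Integrable fun t : ℝ ↦ |t| * (2 * Real.exp |t|)⁻¹ := by
  refine (integrable_inv_one_add_sq.const_mul 7).mono'
    (continuous_abs.mul continuous_weight).aestronglyMeasurable (.of_forall fun t ↦ ?_)
  have h := Real.pow_div_factorial_le_exp |t| (abs_nonneg t) 3
  have h0 := Real.add_one_le_exp |t|
  have ht := abs_nonneg t
  norm_num [Nat.factorial] at h
  rw [Real.norm_of_nonneg (by positivity), ← div_eq_mul_inv, ← div_eq_mul_inv,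
    div_le_div_iff₀ (by positivity) (by positivity), ← sq_abs t]
  nlinarith

lemma integral_weight_pos : 0 < ∫ t : ℝ, (2 * Real.exp |t|)⁻¹ := by
  rw [integral_pos_iff_support_of_nonneg (fun t ↦ by positivity) integrable_weight]
  have : (Function.support fun t : ℝ ↦ (2 * Real.exp |t|)⁻¹) = Set.univ :=
    Set.eq_univ_of_forall fun t ↦ (by positivity : (0 : ℝ) < (2 * Real.exp |t|)⁻¹).ne'
  rw [this]
  simp

section

variable {X : Type*} [MetricSpace X]

lemma dist_apply_zero_le {f : ℝ → X} (hf : LipschitzWith 1 f) (t : ℝ) :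
    dist (f t) (f 0) ≤ |t| := by
  simpa using hf.dist_le_mul t 0

lemma dist_apply_le {f g : ℝ → X} (hf : LipschitzWith 1 f) (hg : LipschitzWith 1 g) (t : ℝ) :
    dist (f t) (g t) ≤ dist (f 0) (g 0) + 2 * |t| := by
  have := dist_triangle4 (f t) (f 0) (g 0) (g t)
  have := dist_apply_zero_le hf t
  have := dist_apply_zero_le hg t
  rw [dist_comm] at this
  linarith

lemma dist_zero_le {f g : ℝ → X} (hf : LipschitzWith 1 f) (hg : LipschitzWith 1 g) (t : ℝ) :
    dist (f 0) (g 0) ≤ dist (f t) (g t) + 2 * |t| := by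
  have := dist_triangle4 (f 0) (f t) (g t) (g 0)
  have := dist_apply_zero_le hg t
  have := dist_apply_zero_le hf t
  rw [dist_comm] at this
  linarith

lemma continuous_lipDist_integrand {f g : ℝ → X} (hf : Continuous f) (hg : Continuous g) :
    Continuous fun t : ℝ ↦ dist (f t) (g t) / (2 * Real.exp |t|) :=
  (hf.dist hg).div (by fun_prop) fun t ↦ by positivity

lemma integrable_affine_mul_weight (a b : ℝ) :
    Integrable fun t : ℝ ↦ a * (2 * Real.exp |t|)⁻¹ + b * (|t| * (2 * Real.exp |t|)⁻¹) :=
  (integrable_weight.const_mul a).add (integrable_abs_mul_weight.const_mul b)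

lemma norm_lipDist_integrand_le {f g : ℝ → X} (hf : LipschitzWith 1 f) (hg : LipschitzWith 1 g)
    {M : ℝ} (hM : dist (f 0) (g 0) ≤ M) (t : ℝ) :
    ‖dist (f t) (g t) / (2 * Real.exp |t|)‖ ≤
      M * (2 * Real.exp |t|)⁻¹ + 2 * (|t| * (2 * Real.exp |t|)⁻¹) := by
  rw [Real.norm_of_nonneg (by positivity), div_eq_mul_inv, ← mul_assoc, ← add_mul]
  gcongr
  linarith [dist_apply_le hf hg t]

lemma dist_zero_mul_sub_le_lipDist {f g : ℝ → X} (hf : LipschitzWith 1 f)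
    (hg : LipschitzWith 1 g) :
    dist (f 0) (g 0) * (∫ t : ℝ, (2 * Real.exp |t|)⁻¹) -
      2 * (∫ t : ℝ, |t| * (2 * Real.exp |t|)⁻¹) ≤ lipDist f g := by
  rw [← integral_const_mul, ← integral_const_mul,
    ← integral_sub (integrable_weight.const_mul _) (integrable_abs_mul_weight.const_mul _)]
  refine integral_mono
    ((integrable_weight.const_mul _).sub (integrable_abs_mul_weight.const_mul _))
    ((integrable_affine_mul_weight _ 2).mono'
      (continuous_lipDist_integrand hf.continuous hg.continuous).aestronglyMeasurable
      (.of_forall (norm_lipDist_integrand_le hf hg le_rfl))) fun t ↦ ?_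
  simp only []
  rw [div_eq_mul_inv, ← mul_assoc, ← sub_mul]
  gcongr
  linarith [dist_zero_le hf hg t]

lemma isInducing_val : Topology.IsInducing (Subtype.val : Lip1 X → C(ℝ, X)) :=
  Topology.IsInducing.subtypeVal

lemma continuousOn_lipDist (f : Lip1 X) (M : ℝ) :
    ContinuousOn (fun g : Lip1 X ↦ lipDist (⇑f.1) (⇑g.1))
      {g : Lip1 X | dist (f.1 0) (g.1 0) ≤ M} := by
  have : FirstCountableTopology (Lip1 X) := isInducing_val.firstCountableTopology
  refine continuousOn_of_dominated
    (fun g _ ↦ (continuous_lipDist_integrand f.1.continuous g.1.continuous).aestronglyMeasurable)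
    (fun g hg ↦ .of_forall (norm_lipDist_integrand_le f.2 g.2 hg))
    (integrable_affine_mul_weight M 2) (.of_forall fun t ↦ Continuous.continuousOn ?_)
  exact (continuous_const.dist
    ((continuous_eval_const t).comp isInducing_val.continuous)).div_const _

lemma isCompact_dist_apply_zero_le [ProperSpace X] (x : X) (M : ℝ) :
    IsCompact {g : Lip1 X | dist x (g.1 0) ≤ M} := by
  refine isInducing_val.isCompact_iff.mpr ?_
  have hlip : ∀ g ∈ (Subtype.val '' {g : Lip1 X | dist x (g.1 0) ≤ M} : Set C(ℝ, X)),
      LipschitzWith 1 g := by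
    rintro _ ⟨g, -, rfl⟩
    exact g.2
  refine ArzelaAscoli.isCompact_of_equicontinuous _ ?_
    (LipschitzWith.uniformEquicontinuous _ 1 fun g ↦ hlip _ g.2).equicontinuous
  have himage : ContinuousMap.toFun '' (Subtype.val '' {g : Lip1 X | dist x (g.1 0) ≤ M}) =
      {g : ℝ → X | LipschitzWith 1 g} ∩ {g | dist x (g 0) ≤ M} := by
    ext g
    constructor
    · rintro ⟨_, ⟨g, hg, rfl⟩, rfl⟩
      exact ⟨g.2, hg⟩
    · rintro ⟨hg, hg0⟩
      exact ⟨⟨g, hg.continuous⟩, ⟨⟨⟨g, hg.continuous⟩, hg⟩, hg0, rfl⟩, rfl⟩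
  refine (congrArg IsCompact himage).mpr ?_
  refine (isCompact_univ_pi fun t : ℝ ↦ isCompact_closedBall x (M + |t|)).of_isClosed_subset
    ((isClosed_setOfPred_lipschitzWith 1).inter
      (isClosed_le (continuous_const.dist (continuous_apply 0)) continuous_const)) ?_
  rintro g ⟨hg, hg0⟩ t -
  have hg0 : dist x (g 0) ≤ M := hg0
  rw [dist_comm] at hg0
  rw [Metric.mem_closedBall]
  linarith [dist_triangle (g t) (g 0) x, dist_apply_zero_le hg t]

end

/-- If `X` is a proper metric space, then `(Lip₁(X), D)` is proper: every closed ball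
`{g : D(f,g) ≤ R}` in `Lip₁(X)` is compact. -/
theorem lip1_properSpace {X : Type*} [MetricSpace X] [ProperSpace X]
    (f : Lip1 X) (R : ℝ) :
    IsCompact {g : Lip1 X | lipDist (⇑f.1) (⇑g.1) ≤ R} := by
  set M := (R + 2 * ∫ t : ℝ, |t| * (2 * Real.exp |t|)⁻¹) / ∫ t : ℝ, (2 * Real.exp |t|)⁻¹
  have hsub : {g : Lip1 X | lipDist (⇑f.1) (⇑g.1) ≤ R} ⊆
      {g : Lip1 X | dist (f.1 0) (g.1 0) ≤ M} := by
    intro g (hg : lipDist (⇑f.1) (⇑g.1) ≤ R)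
    change dist (f.1 0) (g.1 0) ≤ M
    rw [le_div_iff₀ integral_weight_pos]
    linarith [dist_zero_mul_sub_le_lipDist f.2 g.2]
  have hclosed : IsClosed {g : Lip1 X | dist (f.1 0) (g.1 0) ≤ M} :=
    isClosed_le (continuous_const.dist
      ((continuous_eval_const 0).comp isInducing_val.continuous)) continuous_const
  refine (isCompact_dist_apply_zero_le (f.1 0) M).of_isClosed_subset ?_ hsub
  rw [← Set.inter_eq_right.mpr hsub]
  exact (continuousOn_lipDist f M).preimage_isClosed_of_isClosed hclosed isClosed_Iic

end FJ
end

section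
/- Let X be a proper metric space and γ a constant-speed bicombing on X. Then the evaluation map ev₀ : FS(X,γ) → X, f ↦ f(0), is continuous and proper: the preimage of every compact subset of X is compact. -/
open MeasureTheory Set

namespace FJ

/-- A constant-speed bicombing on a metric space `X`: a continuous map
`γ : X × X × [0,1] → X` such that each `γ_{x,y} := γ(x,y,·)` is a rectifiable path from `x`
to `y` of constant speed equal to its length `len x y`. -/
structure ConstSpeedBicombing (X : Type*) [MetricSpace X] where
  toFun : X → X → ℝ → X
  len : X → X → ℝ
  len_nonneg : ∀ x y, 0 ≤ len x y
  continuousOn : ContinuousOn (fun p : X × X × ℝ => toFun p.1 p.2.1 p.2.2)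
      (Set.univ ×ˢ Set.univ ×ˢ Set.Icc (0:ℝ) 1)
  source : ∀ x y, toFun x y 0 = x
  target : ∀ x y, toFun x y 1 = y
  speed : ∀ (x y : X) (s t : ℝ), 0 ≤ s → s ≤ t → t ≤ 1 →
      eVariationOn (toFun x y) (Set.Icc s t) = ENNReal.ofReal (len x y * (t - s))

/-- The trail `c_{x,y} : ℝ → X` associated to a bicombing: constant `x` on `(-∞,0]`,
the path `γ_{x,y}` parametrised by arclength on `[0, len x y]`, constant `y` on
`[len x y, ∞)`. -/
noncomputable def trail {X : Type*} [MetricSpace X] (B : ConstSpeedBicombing X)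
    (x y : X) : ℝ → X :=
  fun t => if t ≤ 0 then x else if t < B.len x y then B.toFun x y (t / B.len x y) else y

/-- `A(X,γ) = {Φ_τ c_{x,y} | τ ∈ ℝ, x, y ∈ X}`, as a subset of `C(ℝ, X)` (whose
compact-open topology induces on `Lip₁(X)` the topology of the metric `D`). -/
def ASet {X : Type*} [MetricSpace X] (B : ConstSpeedBicombing X) : Set C(ℝ, X) :=
  {w | ∃ (x y : X) (τ : ℝ), ∀ s, w s = trail B x y (s + τ)}

/-- The flow space `FS(X,γ)`, the closure of `A(X,γ)`. -/
def FSSet {X : Type*} [MetricSpace X] (B : ConstSpeedBicombing X) : Set C(ℝ, X) :=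
  closure (ASet B)

/-- The restriction `res_{[a,b]}(w)`: equal to `w a` on `(-∞,a]`, to `w` on `[a,b]`,
and to `w b` on `[b,∞)`. -/
noncomputable def trailRes {X : Type*} (a b : ℝ) (w : ℝ → X) : ℝ → X :=
  fun t => if t ≤ a then w a else if t ≤ b then w t else w b

/-- `A(X,γ,[a,b]) = A(X,γ) ∩ Lip₁(X,[a,b])`: the elements of `A(X,γ)` which are constant
on `(-∞,a]` and on `[b,∞)`. -/
def AIntSet {X : Type*} [MetricSpace X] (B : ConstSpeedBicombing X) (a b : ℝ) :
    Set C(ℝ, X) :=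
  {w | w ∈ ASet B ∧ (∀ s, s ≤ a → w s = w a) ∧ (∀ s, b ≤ s → w s = w b)}

/-- A bicombing is consistent if the chosen paths behave well under restriction. -/
def BicombingConsistent {X : Type*} [MetricSpace X] (B : ConstSpeedBicombing X) : Prop :=
  ∀ (x y : X) (s s' t : ℝ), 0 ≤ s → s < s' → s' ≤ 1 → s ≤ t → t ≤ s' →
    B.toFun x y t = B.toFun (B.toFun x y s) (B.toFun x y s') ((t - s) / (s' - s))

/-- A bicombing is `A`-convex if `d(γ_{x,y}(t), γ_{x',y'}(t)) ≤ A(t, d(x,x'), d(y,y'))`. -/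
def BicombingAConvex {X : Type*} [MetricSpace X] (B : ConstSpeedBicombing X)
    (A : ℝ → ℝ → ℝ → ℝ) : Prop :=
  ∀ (x x' y y' : X) (t : ℝ), 0 ≤ t → t ≤ 1 →
    dist (B.toFun x y t) (B.toFun x' y' t) ≤ A t (dist x x') (dist y y')

/-- The conditions on the comparison function `A` of an `A`-convex bicombing:
`A : [0,1] × [0,∞) × [0,∞) → [0,∞)` is continuous with `A(1,s,0) = A(0,0,s) = 0`. -/
def ConvexityFun (A : ℝ → ℝ → ℝ → ℝ) : Prop :=
  ContinuousOn (fun p : ℝ × ℝ × ℝ => A p.1 p.2.1 p.2.2)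
      (Set.Icc (0:ℝ) 1 ×ˢ Set.Ici (0:ℝ) ×ˢ Set.Ici (0:ℝ)) ∧
  (∀ t s s', 0 ≤ t → t ≤ 1 → 0 ≤ s → 0 ≤ s' → 0 ≤ A t s s') ∧
  (∀ s, 0 ≤ s → A 1 s 0 = 0) ∧ (∀ s, 0 ≤ s → A 0 0 s = 0)

/-- The monotonicity conditions on `A`: monotonically increasing in the second and third
arguments and, in the first argument, monotonically increasing on `[0,1/3]` and
monotonically decreasing on `[2/3,1]`. -/
def MonotoneConvexityFun (A : ℝ → ℝ → ℝ → ℝ) : Prop :=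
  (∀ t s₁ s₂ s', 0 ≤ t → t ≤ 1 → 0 ≤ s₁ → s₁ ≤ s₂ → 0 ≤ s' → A t s₁ s' ≤ A t s₂ s') ∧
  (∀ t s s₁ s₂, 0 ≤ t → t ≤ 1 → 0 ≤ s → 0 ≤ s₁ → s₁ ≤ s₂ → A t s s₁ ≤ A t s s₂) ∧
  (∀ t₁ t₂ s s', 0 ≤ t₁ → t₁ ≤ t₂ → t₂ ≤ 1/3 → 0 ≤ s → 0 ≤ s' → A t₁ s s' ≤ A t₂ s s') ∧
  (∀ t₁ t₂ s s', 2/3 ≤ t₁ → t₁ ≤ t₂ → t₂ ≤ 1 → 0 ≤ s → 0 ≤ s' → A t₂ s s' ≤ A t₁ s s')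

/-- The paths of a constant-speed bicombing are Lipschitz with constant `len x y`. -/
theorem ConstSpeedBicombing.dist_toFun_le {X : Type*} [MetricSpace X]
    (B : ConstSpeedBicombing X) (x y : X) {s t : ℝ} (hs : 0 ≤ s) (hst : s ≤ t) (ht : t ≤ 1) :
    dist (B.toFun x y s) (B.toFun x y t) ≤ B.len x y * (t - s) := by
  rw [← edist_le_ofReal (mul_nonneg (B.len_nonneg x y) (sub_nonneg.2 hst)),
    ← B.speed x y s t hs hst ht]
  exact eVariationOn.edist_le _ (left_mem_Icc.2 hst) (right_mem_Icc.2 hst)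

/-- If `len x y` vanishes, then `x = y`. -/
theorem ConstSpeedBicombing.eq_of_len_eq_zero {X : Type*} [MetricSpace X]
    (B : ConstSpeedBicombing X) {x y : X} (h : B.len x y = 0) : x = y := by
  have := B.dist_toFun_le x y le_rfl zero_le_one le_rfl
  rw [h, zero_mul, B.source, B.target] at this
  exact dist_le_zero.1 this

/-- The trail is the arclength parametrisation evaluated at the clamped time. -/
theorem trail_eq_toFun_clamp {X : Type*} [MetricSpace X] (B : ConstSpeedBicombing X)
    {x y : X} (h : 0 < B.len x y) (t : ℝ) :
    trail B x y t = B.toFun x y (max 0 (min t (B.len x y)) / B.len x y) := by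
  unfold trail
  split_ifs with h₀ h₁
  · rw [max_eq_left ((min_le_left _ _).trans h₀), zero_div, B.source]
  · rw [min_eq_left h₁.le, max_eq_right (not_le.1 h₀).le]
  · rw [min_eq_right (not_lt.1 h₁), max_eq_right h.le, div_self h.ne', B.target]

/-- Trails are `1`-Lipschitz. -/
theorem lipschitzWith_trail {X : Type*} [MetricSpace X] (B : ConstSpeedBicombing X) (x y : X) :
    LipschitzWith 1 (trail B x y) := by
  rcases (B.len_nonneg x y).eq_or_lt with h | h
  · obtain rfl := B.eq_of_len_eq_zero h.symm
    have hc : trail B x x = fun _ => x := by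
      funext t
      have : ¬ (¬ t ≤ 0 ∧ t < B.len x x) := by rw [← h]; grind
      grind [trail]
    rw [hc]
    exact LipschitzWith.const' x
  · have key : ∀ s t : ℝ, s ≤ t → dist (trail B x y s) (trail B x y t) ≤ t - s := by
      intro s t hst
      rw [trail_eq_toFun_clamp B h, trail_eq_toFun_clamp B h]
      refine (B.dist_toFun_le x y (by positivity) (by gcongr) ?_).trans ?_
      · exact (div_le_one h).2 (max_le h.le (min_le_right _ _))
      · rw [← sub_div, mul_div_cancel₀ _ h.ne']
        grind
    refine LipschitzWith.of_dist_le_mul fun s t => ?_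
    rw [NNReal.coe_one, one_mul, Real.dist_eq]
    rcases le_total s t with hst | hst
    · rw [abs_sub_comm]
      exact (key s t hst).trans (le_abs_self _)
    · rw [dist_comm]
      exact (key t s hst).trans (le_abs_self _)

/-- Elements of the flow space are `1`-Lipschitz. -/
theorem lipschitzWith_of_mem_FSSet {X : Type*} [MetricSpace X] (B : ConstSpeedBicombing X)
    {w : C(ℝ, X)} (hw : w ∈ FSSet B) : LipschitzWith 1 w := by
  have hclosed : IsClosed {w : C(ℝ, X) | LipschitzWith 1 w} :=
    (isClosed_setOfPred_lipschitzWith 1).preimage continuous_coeFun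
  refine closure_minimal ?_ hclosed hw
  rintro v ⟨x, y, τ, hv⟩
  have hshift : LipschitzWith 1 fun s : ℝ => s + τ :=
    LipschitzWith.of_dist_le_mul fun a b => by simp
  have := (lipschitzWith_trail B x y).comp hshift
  rw [mul_one] at this
  rwa [Set.mem_ofPred_eq, show (v : ℝ → X) = trail B x y ∘ fun s => s + τ from funext hv]

/-- In a proper space, the `K`-Lipschitz maps sending a fixed point into a fixed compact set
form a compact subset of the space of continuous maps. -/
theorem isCompact_setOf_lipschitzWith_apply_mem {Y X : Type*} [PseudoMetricSpace Y]
    [MetricSpace X] [ProperSpace X] (C : NNReal) (y₀ : Y) {K : Set X} (hK : IsCompact K) :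
    IsCompact {w : C(Y, X) | LipschitzWith C w ∧ w y₀ ∈ K} := by
  refine ArzelaAscoli.isCompact_of_equicontinuous _ ?_ ?_
  · have himage : ContinuousMap.toFun '' {w : C(Y, X) | LipschitzWith C w ∧ w y₀ ∈ K} =
        {f : Y → X | LipschitzWith C f} ∩ {f : Y → X | f y₀ ∈ K} := by
      ext f
      constructor
      · rintro ⟨w, hw, rfl⟩
        exact hw
      · exact fun hf => ⟨⟨f, hf.1.continuous⟩, hf, rfl⟩
    rw [himage]
    refine IsCompact.of_isClosed_subset
      (isCompact_univ_pi fun y : Y => hK.cthickening (r := C * dist y y₀))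
      ((isClosed_setOfPred_lipschitzWith C).inter
        (hK.isClosed.preimage (continuous_apply y₀))) ?_
    rintro f ⟨hf, hfK⟩ y -
    exact Metric.mem_cthickening_of_dist_le _ _ _ _ hfK (hf.dist_le_mul y y₀)
  · exact (LipschitzWith.uniformEquicontinuous _ C fun w => w.2.1).equicontinuous

/-- For a proper metric space `X` with a constant-speed bicombing `γ`, the evaluation map
`ev₀ : FS(X,γ) → X`, `f ↦ f(0)`, is continuous and proper. -/
theorem ev_zero_continuous_and_proper {X : Type*} [MetricSpace X] [ProperSpace X]
    (B : ConstSpeedBicombing X) :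
    Continuous (fun w : {w : C(ℝ, X) // w ∈ FSSet B} => w.1 0) ∧
    ∀ K : Set X, IsCompact K →
      IsCompact {w : {w : C(ℝ, X) // w ∈ FSSet B} | w.1 0 ∈ K} := by
  have hev : Continuous fun w : {w : C(ℝ, X) // w ∈ FSSet B} => w.1 0 :=
    (continuous_eval_const (F := C(ℝ, X)) 0).comp continuous_subtype_val
  refine ⟨hev, fun K hK => ?_⟩
  have hemb : Topology.IsClosedEmbedding
      (Subtype.val : {w : C(ℝ, X) // w ∈ FSSet B} → C(ℝ, X)) :=
    isClosed_closure.isClosedEmbedding_subtypeVal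
  refine (hemb.isCompact_preimage
    (isCompact_setOf_lipschitzWith_apply_mem 1 (0 : ℝ) hK)).of_isClosed_subset
    (hK.isClosed.preimage hev) ?_
  exact fun w hw => ⟨lipschitzWith_of_mem_FSSet B w.2, hw⟩

end FJ
end

section
/- Let X be a proper metric space with a cocompact isometric action of a group G, and let γ be a G-equivariant constant-speed bicombing on X. Then the induced G-action on FS(X,γ), given by (g·w)(t) = g·w(t), is cocompact: there exists a compact subset K ⊆ FS(X,γ) with G·K = FS(X,γ). -/
open MeasureTheory Set

namespace FJ

/-- A trail is the bicombing path evaluated at the clamped and rescaled time. -/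
theorem trail_eq_toFun {X : Type*} [MetricSpace X] (B : ConstSpeedBicombing X) (x y : X) (t : ℝ) :
    trail B x y t = B.toFun x y (max 0 (min t (B.len x y)) / B.len x y) := by
  have hl := B.len_nonneg x y
  unfold trail
  split_ifs with h₀ h₁
  · rw [max_eq_left (min_le_of_left_le h₀), zero_div, B.source]
  · rw [min_eq_left h₁.le, max_eq_right (not_le.1 h₀).le]
  · rw [min_eq_right (not_lt.1 h₁), max_eq_right hl]
    rcases hl.eq_or_lt with h | h
    · have hd := B.dist_toFun_le x y le_rfl zero_le_one le_rfl
      rw [B.source, B.target, ← h, zero_mul] at hd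
      rw [← h, zero_div, B.source, dist_le_zero.1 hd]
    · rw [div_self h.ne', B.target]

/-- Lipschitz paths in a proper space starting in a compact set form a compact set. -/
theorem isCompact_setOf_lipschitzWith_one {X : Type*} [MetricSpace X] [ProperSpace X]
    {K : Set X} (hK : IsCompact K) :
    IsCompact {f : C(ℝ, X) | LipschitzWith 1 f ∧ f 0 ∈ K} := by
  refine ArzelaAscoli.isCompact_of_equicontinuous _ ?_ ?_
  · have himage : ContinuousMap.toFun '' {f : C(ℝ, X) | LipschitzWith 1 f ∧ f 0 ∈ K} =
        {f : ℝ → X | (∀ s t, dist (f s) (f t) ≤ dist s t) ∧ f 0 ∈ K} := by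
      ext f
      constructor
      · rintro ⟨f, ⟨hf, hf₀⟩, rfl⟩
        exact ⟨fun s t => by simpa using hf.dist_le_mul s t, hf₀⟩
      · rintro ⟨hf, hf₀⟩
        have hf' := LipschitzWith.mk_one hf
        exact ⟨⟨f, hf'.continuous⟩, ⟨hf', hf₀⟩, rfl⟩
    rw [himage]
    have hcpt : IsCompact (univ.pi fun t : ℝ => Metric.cthickening |t| K) :=
      isCompact_univ_pi fun t => hK.cthickening
    refine hcpt.of_isClosed_subset ?_ ?_
    · simp only [ofPred_and, ofPred_forall]
      refine IsClosed.inter (isClosed_iInter fun s => isClosed_iInter fun t => isClosed_le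
        ((continuous_apply s).dist (continuous_apply t)) continuous_const) ?_
      exact hK.isClosed.preimage (continuous_apply (0 : ℝ))
    · rintro f ⟨hf, hf₀⟩ t -
      refine Metric.mem_cthickening_of_dist_le (f t) (f 0) _ _ hf₀ ?_
      simpa using hf t 0
  · exact (LipschitzWith.uniformEquicontinuous _ 1 fun f => f.2.1).equicontinuous

theorem eVariationOn_isometry_comp {α E F : Type*} [LinearOrder α] [PseudoEMetricSpace E]
    [PseudoEMetricSpace F] {φ : E → F} (hφ : Isometry φ) (f : α → E) (s : Set α) :
    eVariationOn (φ ∘ f) s = eVariationOn f s := by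
  simp only [eVariationOn, Function.comp_apply, hφ.edist_eq]

section Equivariance

variable {X : Type*} [MetricSpace X] {G : Type*} [Group G] [MulAction G X]

theorem ConstSpeedBicombing.len_smul (hiso : ∀ g : G, Isometry (fun x : X => g • x))
    (B : ConstSpeedBicombing X)
    (hequiv : ∀ (g : G) (x y : X) (t : ℝ), 0 ≤ t → t ≤ 1 →
      g • B.toFun x y t = B.toFun (g • x) (g • y) t) (g : G) (x y : X) :
    B.len (g • x) (g • y) = B.len x y := by
  have h := B.speed (g • x) (g • y) 0 1 le_rfl zero_le_one le_rfl
  have hcongr : EqOn (B.toFun (g • x) (g • y)) ((fun z => g • z) ∘ B.toFun x y) (Icc 0 1) :=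
    fun t ht => (hequiv g x y t ht.1 ht.2).symm
  rw [eVariationOn.eq_of_eqOn hcongr, eVariationOn_isometry_comp (hiso g),
    B.speed x y 0 1 le_rfl zero_le_one le_rfl, sub_zero, mul_one, mul_one,
    ENNReal.ofReal_eq_ofReal_iff (B.len_nonneg _ _) (B.len_nonneg _ _)] at h
  exact h.symm

theorem smul_trail (hiso : ∀ g : G, Isometry (fun x : X => g • x))
    (B : ConstSpeedBicombing X)
    (hequiv : ∀ (g : G) (x y : X) (t : ℝ), 0 ≤ t → t ≤ 1 →
      g • B.toFun x y t = B.toFun (g • x) (g • y) t) (g : G) (x y : X) (t : ℝ) :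
    g • trail B x y t = trail B (g • x) (g • y) t := by
  have hl := B.len_nonneg x y
  rw [trail_eq_toFun, trail_eq_toFun, B.len_smul hiso hequiv]
  exact hequiv g x y _ (by positivity)
    (div_le_one_of_le₀ (max_le hl (min_le_right _ _)) hl)

theorem smul_comp_mem_FSSet (hiso : ∀ g : G, Isometry (fun x : X => g • x))
    (B : ConstSpeedBicombing X)
    (hequiv : ∀ (g : G) (x y : X) (t : ℝ), 0 ≤ t → t ≤ 1 →
      g • B.toFun x y t = B.toFun (g • x) (g • y) t) (g : G) {w : C(ℝ, X)} (hw : w ∈ FSSet B) :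
    (⟨fun x : X => g • x, (hiso g).continuous⟩ : C(X, X)).comp w ∈ FSSet B := by
  refine map_mem_closure (ContinuousMap.continuous_postcomp _) hw ?_
  rintro f ⟨x, y, τ, hf⟩
  refine ⟨g • x, g • y, τ, fun s => ?_⟩
  rw [← smul_trail hiso B hequiv, ← hf]
  rfl

end Equivariance

/-- If `X` is a proper metric space with a cocompact isometric `G`-action and `γ` is a
`G`-equivariant constant-speed bicombing, then the induced `G`-action on `FS(X,γ)`,
`(g·w)(t) = g·(w t)`, is cocompact: there is a compact `K ⊆ FS(X,γ)` with
`G·K = FS(X,γ)`. -/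
theorem fsset_cocompact {X : Type*} [MetricSpace X] [ProperSpace X]
    {G : Type*} [Group G] [MulAction G X]
    (hiso : ∀ g : G, Isometry (fun x : X => g • x))
    (hcocpt : ∃ K : Set X, IsCompact K ∧ ∀ x : X, ∃ g : G, ∃ k ∈ K, x = g • k)
    (B : ConstSpeedBicombing X)
    (hequiv : ∀ (g : G) (x y : X) (t : ℝ), 0 ≤ t → t ≤ 1 →
      g • B.toFun x y t = B.toFun (g • x) (g • y) t) :
    ∃ K : Set C(ℝ, X), IsCompact K ∧ K ⊆ FSSet B ∧
      ∀ w ∈ FSSet B, ∃ g : G, ∃ k ∈ K, ∀ t : ℝ, w t = g • k t := by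
  obtain ⟨K, hK, hcover⟩ := hcocpt
  refine ⟨FSSet B ∩ {f | LipschitzWith 1 f ∧ f 0 ∈ K},
    (isCompact_setOf_lipschitzWith_one hK).inter_left isClosed_closure, inter_subset_left, ?_⟩
  intro w hw
  obtain ⟨g, k, hk, hgk⟩ := hcover (w 0)
  have hmem := smul_comp_mem_FSSet hiso B hequiv g⁻¹ hw
  refine ⟨g, _, ⟨hmem, lipschitzWith_of_mem_FSSet B hmem, ?_⟩, fun t => ?_⟩
  · simpa [hgk] using hk
  · simp
end FJ
end

section
/- Let X be a metric space with a proper isometric action of a group G (i.e. for every compact L ⊆ X the set {g ∈ G : gL ∩ L ≠ ∅} is finite), and let γ be a G-equivariant constant-speed bicombing on X. Then the induced G-action on FS(X,γ), given by (g·w)(t) = g·w(t), is proper: for every compact subset K ⊆ FS(X,γ) the set {g ∈ G : gK ∩ K ≠ ∅} is finite. -/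
open MeasureTheory Set

namespace FJ

/-- If `X` is a metric space with a proper isometric `G`-action and `γ` is a
`G`-equivariant constant-speed bicombing, then the induced `G`-action on `FS(X,γ)`,
`(g·w)(t) = g·(w t)`, is proper: for every compact `K ⊆ FS(X,γ)` the set
`{g : G | gK ∩ K ≠ ∅}` is finite. -/
theorem fsset_properAction {X : Type*} [MetricSpace X]
    {G : Type*} [Group G] [MulAction G X]
    (hiso : ∀ g : G, Isometry (fun x : X => g • x))
    (hproper : ∀ L : Set X, IsCompact L → {g : G | ∃ x ∈ L, g • x ∈ L}.Finite)
    (B : ConstSpeedBicombing X)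
    (hequiv : ∀ (g : G) (x y : X) (t : ℝ), 0 ≤ t → t ≤ 1 →
      g • B.toFun x y t = B.toFun (g • x) (g • y) t) :
    ∀ K : Set C(ℝ, X), IsCompact K → K ⊆ FSSet B →
      {g : G | ∃ w ∈ K, ∃ w' ∈ K, ∀ t : ℝ, w' t = g • w t}.Finite := by
  intro K hK _
  refine (hproper ((fun w : C(ℝ, X) => w 0) '' K)
    (hK.image (continuous_eval_const (0 : ℝ)))).subset ?_
  rintro g ⟨w, hw, w', hw', h⟩
  exact ⟨w 0, mem_image_of_mem _ hw, w', hw', h 0⟩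
end FJ
end

section
/- Let (X,d) and (X',d') be metric spaces with constant-speed bicombings γ and γ' respectively, and endow X × X' with the ℓ²-product metric d̄((x,x'),(y,y')) = (d(x,y)² + d'(x',y')²)^{1/2}. Then the map γ̄((x,x'),(y,y'),t) := (γ(x,y,t), γ'(x',y',t)) is a constant-speed bicombing on X × X'; it is consistent if both γ and γ' are consistent; and if γ is A-convex and γ' is A'-convex where A and A' are monotonically increasing in their second and third arguments and, in their first argument, monotonically increasing on [0,1/3] and monotonically decreasing on [2/3,1], then γ̄ is Ā-convex for Ā(t,s,s') := (A(t,s,s')² + A'(t,s,s')²)^{1/2}. -/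
open MeasureTheory Set

namespace FJ

theorem dist_toLp_prod {X X' : Type*} [MetricSpace X] [MetricSpace X']
    (p q : WithLp 2 (X × X')) :
    dist p q = √(dist p.fst q.fst ^ 2 + dist p.snd q.snd ^ 2) := by
  have h := WithLp.prod_dist_eq_add (p := 2) (by norm_num) p q
  simpa [Real.sqrt_eq_rpow] using h

/-- A superadditive interval function dominating a multiple of the displacement of `f` dominates
the same multiple of the variation of `f`. -/
theorem ofReal_mul_eVariationOn_le {E : Type*} [PseudoMetricSpace E] {f : ℝ → E}
    {Φ : ℝ → ℝ → ℝ} {b S T : ℝ} (hb : 0 ≤ b)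
    (hadd : ∀ x y z, S ≤ x → x ≤ y → y ≤ z → z ≤ T → Φ x y + Φ y z ≤ Φ x z)
    (hdist : ∀ x y, S ≤ x → x ≤ y → y ≤ T → b * dist (f x) (f y) ≤ Φ x y) :
    ENNReal.ofReal b * eVariationOn f (Icc S T) ≤ ENNReal.ofReal (Φ S T) := by
  have hnonneg : ∀ x y, S ≤ x → x ≤ y → y ≤ T → 0 ≤ Φ x y := fun x y hx hxy hy =>
    (mul_nonneg hb dist_nonneg).trans (hdist x y hx hxy hy)
  rw [eVariationOn, ENNReal.mul_iSup]
  refine iSup_le ?_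
  rintro ⟨n, u, hu, hus⟩
  have hsum : ∀ k, b * ∑ i ∈ Finset.range k, dist (f (u (i + 1))) (f (u i)) ≤ Φ (u 0) (u k) := by
    intro k
    induction k with
    | zero => simpa using hnonneg _ _ (hus 0).1 le_rfl (hus 0).2
    | succ k ih =>
      rw [Finset.sum_range_succ, mul_add, dist_comm (f (u (k + 1)))]
      have h₁ := hdist (u k) (u (k + 1)) (hus k).1 (hu k.le_succ) (hus _).2
      have h₂ := hadd (u 0) (u k) (u (k + 1)) (hus 0).1 (hu k.zero_le) (hu k.le_succ) (hus _).2
      linarith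
  simp only [edist_dist]
  rw [← ENNReal.ofReal_sum_of_nonneg fun _ _ => dist_nonneg, ← ENNReal.ofReal_mul hb]
  refine ENNReal.ofReal_le_ofReal ((hsum n).trans ?_)
  have h₁ := hadd S (u 0) (u n) le_rfl (hus 0).1 (hu n.zero_le) (hus n).2
  have h₂ := hadd S (u n) T le_rfl (hus n).1 (hus n).2 le_rfl
  have h₃ := hnonneg S (u 0) le_rfl (hus 0).1 (hus 0).2
  have h₄ := hnonneg (u n) T (hus n).1 (hus n).2 le_rfl
  linarith

theorem dist_le_of_eVariationOn_eq {E : Type*} [PseudoMetricSpace E] {f : ℝ → E} {x y l : ℝ}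
    (hxy : x ≤ y) (hl : 0 ≤ l) (h : eVariationOn f (Icc x y) = ENNReal.ofReal l) :
    dist (f x) (f y) ≤ l := by
  have := eVariationOn.edist_le f (left_mem_Icc.2 hxy) (right_mem_Icc.2 hxy)
  rwa [h, edist_dist, ENNReal.ofReal_le_ofReal_iff hl] at this

/-- The `ℓ²`-product of paths of constant speeds `a` and `b` has constant speed `√(a² + b²)`. -/
theorem eVariationOn_toLp_prod {X X' : Type*} [MetricSpace X] [MetricSpace X']
    {f : ℝ → X} {g : ℝ → X'} {a b S T : ℝ} (ha : 0 ≤ a) (hb : 0 ≤ b) (hST : S ≤ T)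
    (hf : ∀ x y, S ≤ x → x ≤ y → y ≤ T →
      eVariationOn f (Icc x y) = ENNReal.ofReal (a * (y - x)))
    (hg : ∀ x y, S ≤ x → x ≤ y → y ≤ T →
      eVariationOn g (Icc x y) = ENNReal.ofReal (b * (y - x))) :
    eVariationOn (fun t => WithLp.toLp 2 (f t, g t)) (Icc S T)
      = ENNReal.ofReal (√(a ^ 2 + b ^ 2) * (T - S)) := by
  set h : ℝ → WithLp 2 (X × X') := fun t => WithLp.toLp 2 (f t, g t) with h_def
  set c := √(a ^ 2 + b ^ 2) with c_def
  have hc : 0 ≤ c := Real.sqrt_nonneg _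
  have hc2 : c ^ 2 = a ^ 2 + b ^ 2 := Real.sq_sqrt (by positivity)
  have hdist : ∀ x y, dist (h x) (h y) = √(dist (f x) (f y) ^ 2 + dist (g x) (g y) ^ 2) :=
    fun x y => dist_toLp_prod _ _
  have upper : ∀ x y, S ≤ x → x ≤ y → y ≤ T →
      eVariationOn h (Icc x y) ≤ ENNReal.ofReal (c * (y - x)) := by
    intro x y hx hxy hy
    have := ofReal_mul_eVariationOn_le (f := h) (S := x) (T := y)
      (Φ := fun x y => c * (y - x)) zero_le_one
      (fun x y z _ _ _ _ => by linarith)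
      (fun p q hp hpq hq => by
        have h₁ := dist_le_of_eVariationOn_eq hpq (mul_nonneg ha (sub_nonneg.2 hpq))
          (hf p q (hx.trans hp) hpq (hq.trans hy))
        have h₂ := dist_le_of_eVariationOn_eq hpq (mul_nonneg hb (sub_nonneg.2 hpq))
          (hg p q (hx.trans hp) hpq (hq.trans hy))
        rw [one_mul, hdist]
        refine Real.sqrt_le_iff.2 ⟨mul_nonneg hc (sub_nonneg.2 hpq), ?_⟩
        calc dist (f p) (f q) ^ 2 + dist (g p) (g q) ^ 2
            ≤ (a * (q - p)) ^ 2 + (b * (q - p)) ^ 2 := by gcongr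
          _ = (c * (q - p)) ^ 2 := by rw [mul_pow c, hc2]; ring)
    simpa using this
  set w : ℝ → ℝ → ℝ := fun x y => (eVariationOn h (Icc x y)).toReal with w_def
  have hfin : ∀ x y, S ≤ x → x ≤ y → y ≤ T → eVariationOn h (Icc x y) ≠ ⊤ :=
    fun x y hx hxy hy => ne_top_of_le_ne_top ENNReal.ofReal_ne_top (upper x y hx hxy hy)
  have w_add : ∀ x y z, S ≤ x → x ≤ y → y ≤ z → z ≤ T → w x y + w y z = w x z := by
    intro x y z hx hxy hyz hz
    have := eVariationOn.Icc_add_Icc h hxy hyz (mem_univ y)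
    simp only [univ_inter] at this
    simp only [w_def]
    rw [← ENNReal.toReal_add (hfin x y hx hxy (hyz.trans hz)) (hfin y z (hx.trans hxy) hyz hz),
      this]
  have dist_le_w : ∀ x y, S ≤ x → x ≤ y → y ≤ T →
      a * dist (f x) (f y) + b * dist (g x) (g y) ≤ c * w x y := by
    intro x y hx hxy hy
    have h₁ : dist (h x) (h y) ≤ w x y := dist_le_of_eVariationOn_eq hxy ENNReal.toReal_nonneg
      (ENNReal.ofReal_toReal (hfin x y hx hxy hy)).symm
    refine le_trans ?_ (mul_le_mul_of_nonneg_left h₁ hc)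
    rw [hdist, c_def, ← Real.sqrt_mul (by positivity)]
    apply Real.le_sqrt_of_sq_le
    nlinarith [sq_nonneg (a * dist (g x) (g y) - b * dist (f x) (f y))]
  have left_le_w : ∀ x y, S ≤ x → x ≤ y → y ≤ T →
      a * dist (f x) (f y) ≤ c * w x y - b ^ 2 * (y - x) := by
    intro x y hx hxy hy
    have := ofReal_mul_eVariationOn_le (f := g) (S := x) (T := y)
      (Φ := fun x y => c * w x y - a * dist (f x) (f y)) hb
      (fun p q r hp hpq hqr hr => by
        have h₁ := w_add p q r (hx.trans hp) hpq hqr (hr.trans hy)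
        have h₂ := mul_le_mul_of_nonneg_left (dist_triangle (f p) (f q) (f r)) ha
        simp only [← h₁]
        linarith)
      (fun p q hp hpq hq => by linarith [dist_le_w p q (hx.trans hp) hpq (hq.trans hy)])
    rw [hg x y hx hxy hy, ← ENNReal.ofReal_mul hb, ENNReal.ofReal_le_ofReal_iff] at this
    · linarith
    · linarith [dist_le_w x y hx hxy hy, mul_nonneg hb (dist_nonneg (x := g x) (y := g y))]
  have lower : c ^ 2 * (T - S) ≤ c * w S T := by
    have := ofReal_mul_eVariationOn_le (f := f) (S := S) (T := T)
      (Φ := fun x y => c * w x y - b ^ 2 * (y - x)) ha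
      (fun p q r hp hpq hqr hr => by
        simp only [← w_add p q r hp hpq hqr hr]
        linarith)
      left_le_w
    rw [hf S T le_rfl hST le_rfl, ← ENNReal.ofReal_mul ha, ENNReal.ofReal_le_ofReal_iff] at this
    · rw [hc2]; linarith
    · exact (mul_nonneg ha dist_nonneg).trans (left_le_w S T le_rfl hST le_rfl)
  refine le_antisymm (upper S T le_rfl hST le_rfl) ?_
  rcases hc.eq_or_lt with hc0 | hc0
  · simp [← hc0]
  · refine ENNReal.ofReal_le_of_le_toReal (le_of_mul_le_mul_left ?_ hc0)
    linarith

/-- The `ℓ²`-product of two constant-speed bicombings. -/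
noncomputable def ConstSpeedBicombing.prod {X X' : Type*} [MetricSpace X] [MetricSpace X']
    (B : ConstSpeedBicombing X) (B' : ConstSpeedBicombing X') :
    ConstSpeedBicombing (WithLp 2 (X × X')) where
  toFun p q t := WithLp.toLp 2 (B.toFun p.fst q.fst t, B'.toFun p.snd q.snd t)
  len p q := √(B.len p.fst q.fst ^ 2 + B'.len p.snd q.snd ^ 2)
  len_nonneg _ _ := Real.sqrt_nonneg _
  continuousOn := by
    refine (WithLp.prod_continuous_toLp 2 X X').comp_continuousOn (ContinuousOn.prodMk ?_ ?_)
    · exact B.continuousOn.comp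
        (f := fun p : WithLp 2 (X × X') × WithLp 2 (X × X') × ℝ => (p.1.fst, p.2.1.fst, p.2.2))
        (by fun_prop) fun p hp => ⟨trivial, trivial, hp.2.2⟩
    · exact B'.continuousOn.comp
        (f := fun p : WithLp 2 (X × X') × WithLp 2 (X × X') × ℝ => (p.1.snd, p.2.1.snd, p.2.2))
        (by fun_prop) fun p hp => ⟨trivial, trivial, hp.2.2⟩
  source p q := by simp only [B.source, B'.source]; rfl
  target p q := by simp only [B.target, B'.target]; rfl
  speed p q s t hs hst ht :=
    eVariationOn_toLp_prod (B.len_nonneg _ _) (B'.len_nonneg _ _) hst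
      (fun x y hx hxy hy => B.speed _ _ x y (hs.trans hx) hxy (hy.trans ht))
      (fun x y hx hxy hy => B'.speed _ _ x y (hs.trans hx) hxy (hy.trans ht))

/-- Product of bicombings: given constant-speed bicombings `γ` on `X` and `γ'` on `X'`,
the map `γ̄((x,x'),(y,y'),t) = (γ(x,y,t), γ'(x',y',t))` is a constant-speed bicombing on
`X × X'` with the `ℓ²`-product metric; it is consistent if `γ` and `γ'` are, and if `γ` is
`A`-convex and `γ'` is `A'`-convex with `A, A'` satisfying the monotonicity conditions,
then `γ̄` is `Ā`-convex for `Ā = (A² + A'²)^{1/2}`. -/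
theorem prod_bicombing {X X' : Type*} [MetricSpace X] [MetricSpace X']
    (B : ConstSpeedBicombing X) (B' : ConstSpeedBicombing X') :
    ∃ C : ConstSpeedBicombing (WithLp 2 (X × X')),
      (∀ (x y : X) (x' y' : X') (t : ℝ),
        C.toFun ((WithLp.equiv 2 (X × X')).symm (x, x'))
            ((WithLp.equiv 2 (X × X')).symm (y, y')) t
          = (WithLp.equiv 2 (X × X')).symm (B.toFun x y t, B'.toFun x' y' t)) ∧
      (BicombingConsistent B → BicombingConsistent B' → BicombingConsistent C) ∧
      ∀ A A' : ℝ → ℝ → ℝ → ℝ,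
        MonotoneConvexityFun A → MonotoneConvexityFun A' →
        BicombingAConvex B A → BicombingAConvex B' A' →
        BicombingAConvex C
          (fun t s s' => Real.sqrt (A t s s' ^ 2 + A' t s s' ^ 2)) := by
  refine ⟨B.prod B', fun _ _ _ _ _ => rfl, ?_, ?_⟩
  · intro hB hB' p q s s' t hs hss' hs' hst hts'
    exact congrArg (WithLp.toLp 2) (Prod.ext (hB p.fst q.fst s s' t hs hss' hs' hst hts')
      (hB' p.snd q.snd s s' t hs hss' hs' hst hts'))
  · intro A A' hA hA' hB hB' p p' q q' t ht ht1
    have fst_le : ∀ u v : WithLp 2 (X × X'), dist u.fst v.fst ≤ dist u v := fun u v => by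
      rw [dist_toLp_prod]
      exact Real.le_sqrt_of_sq_le (le_add_of_nonneg_right (sq_nonneg _))
    have snd_le : ∀ u v : WithLp 2 (X × X'), dist u.snd v.snd ≤ dist u v := fun u v => by
      rw [dist_toLp_prod]
      exact Real.le_sqrt_of_sq_le (le_add_of_nonneg_left (sq_nonneg _))
    rw [dist_toLp_prod]
    refine Real.sqrt_le_sqrt (add_le_add (pow_le_pow_left₀ dist_nonneg ?_ 2)
      (pow_le_pow_left₀ dist_nonneg ?_ 2))
    · exact (hB p.fst p'.fst q.fst q'.fst t ht ht1).trans
        ((hA.1 _ _ _ _ ht ht1 dist_nonneg (fst_le p p') dist_nonneg).trans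
          (hA.2.1 _ _ _ _ ht ht1 dist_nonneg dist_nonneg (fst_le q q')))
    · exact (hB' p.snd p'.snd q.snd q'.snd t ht ht1).trans
        ((hA'.1 _ _ _ _ ht ht1 dist_nonneg (snd_le p p') dist_nonneg).trans
          (hA'.2.1 _ _ _ _ ht ht1 dist_nonneg dist_nonneg (snd_le q q')))
end FJ
end

section
/- Let A : [0,1] × [0,∞) × [0,∞) → [0,∞) be a continuous function with A(1,s,0) = A(0,0,s) = 0 for all s ≥ 0. Then there exists a continuous function A' : [0,1] × [0,∞) × [0,∞) → [0,∞) with A' ≥ A pointwise, A'(1,s,0) = A'(0,0,s) = 0 for all s ≥ 0, such that A' is monotonically increasing in its second and third arguments and, in its first argument, monotonically increasing on [0,1/3] and monotonically decreasing on [2/3,1]. In particular, every A-convex bicombing is A'-convex. -/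
open MeasureTheory Set

namespace FJ

universe u

/-- The supremum of `F` over the box `[l, h] × [0, s] × [0, s']`, written as a supremum over
the unit cube. -/
noncomputable def boxSup (F : ℝ → ℝ → ℝ → ℝ) (l h s s' : ℝ) : ℝ :=
  sSup ((fun q : ℝ × ℝ × ℝ =>
    F ((1 - q.1) * l + q.1 * h) (q.2.1 * s) (q.2.2 * s')) ''
      (Icc (0:ℝ) 1 ×ˢ Icc (0:ℝ) 1 ×ˢ Icc (0:ℝ) 1))

theorem continuous_boxSup {F : ℝ → ℝ → ℝ → ℝ}
    (hF : Continuous fun p : ℝ × ℝ × ℝ => F p.1 p.2.1 p.2.2) :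
    Continuous fun p : ℝ × ℝ × ℝ × ℝ => boxSup F p.1 p.2.1 p.2.2.1 p.2.2.2 := by
  refine IsCompact.continuous_sSup (isCompact_Icc.prod (isCompact_Icc.prod isCompact_Icc))
    (f := fun (p : ℝ × ℝ × ℝ × ℝ) (q : ℝ × ℝ × ℝ) =>
      F ((1 - q.1) * p.1 + q.1 * p.2.1) (q.2.1 * p.2.2.1) (q.2.2 * p.2.2.2)) ?_
  exact hF.comp (f := fun x : (ℝ × ℝ × ℝ × ℝ) × (ℝ × ℝ × ℝ) =>
    ((1 - x.2.1) * x.1.1 + x.2.1 * x.1.2.1, x.2.2.1 * x.1.2.2.1, x.2.2.2 * x.1.2.2.2))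
    (by fun_prop)

theorem exists_convex_combination {l h u : ℝ} (hl : l ≤ u) (hh : u ≤ h) :
    ∃ θ ∈ Icc (0:ℝ) 1, (1 - θ) * l + θ * h = u := by
  have hu : u ∈ segment ℝ l h := by
    rw [segment_eq_Icc (hl.trans hh)]
    exact ⟨hl, hh⟩
  rw [segment_eq_image] at hu
  simpa only [smul_eq_mul, mem_image] using hu

theorem le_boxSup {F : ℝ → ℝ → ℝ → ℝ}
    (hF : Continuous fun p : ℝ × ℝ × ℝ => F p.1 p.2.1 p.2.2)
    {l h s s' u a b : ℝ} (hlu : l ≤ u) (huh : u ≤ h) (ha : 0 ≤ a) (has : a ≤ s)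
    (hb : 0 ≤ b) (hbs : b ≤ s') : F u a b ≤ boxSup F l h s s' := by
  obtain ⟨x, hx, hxu⟩ := exists_convex_combination hlu huh
  obtain ⟨y, hy, hya⟩ := exists_convex_combination ha has
  obtain ⟨z, hz, hzb⟩ := exists_convex_combination hb hbs
  rw [mul_zero, zero_add] at hya hzb
  refine le_csSup ?_ ⟨(x, y, z), ⟨hx, hy, hz⟩, by simp only [hxu, hya, hzb]⟩
  refine ((isCompact_Icc.prod (isCompact_Icc.prod isCompact_Icc)).image ?_).bddAbove
  exact hF.comp (f := fun q : ℝ × ℝ × ℝ =>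
    ((1 - q.1) * l + q.1 * h, q.2.1 * s, q.2.2 * s')) (by fun_prop)

theorem boxSup_le {F : ℝ → ℝ → ℝ → ℝ} {l h s s' M : ℝ} (hlh : l ≤ h) (hs : 0 ≤ s)
    (hs' : 0 ≤ s')
    (hM : ∀ u a b, l ≤ u → u ≤ h → 0 ≤ a → a ≤ s → 0 ≤ b → b ≤ s' → F u a b ≤ M) :
    boxSup F l h s s' ≤ M := by
  refine csSup_le ⟨_, mem_image_of_mem _
    (show ((0:ℝ), (0:ℝ), (0:ℝ)) ∈ _ from by simp)⟩ ?_
  rintro _ ⟨⟨x, y, z⟩, ⟨⟨hx0, hx1⟩, ⟨hy0, hy1⟩, ⟨hz0, hz1⟩⟩, rfl⟩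
  dsimp only at *
  exact hM _ _ _ (by nlinarith) (by nlinarith) (mul_nonneg hy0 hs)
    (mul_le_of_le_one_left hs hy1) (mul_nonneg hz0 hs') (mul_le_of_le_one_left hs' hz1)

theorem boxSup_mono {F : ℝ → ℝ → ℝ → ℝ}
    (hF : Continuous fun p : ℝ × ℝ × ℝ => F p.1 p.2.1 p.2.2)
    {l₁ h₁ s₁ s₁' l₂ h₂ s₂ s₂' : ℝ} (hlh : l₁ ≤ h₁) (h0 : 0 ≤ s₁) (h0' : 0 ≤ s₁')
    (hl : l₂ ≤ l₁) (hh : h₁ ≤ h₂) (hs : s₁ ≤ s₂) (hs' : s₁' ≤ s₂') :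
    boxSup F l₁ h₁ s₁ s₁' ≤ boxSup F l₂ h₂ s₂ s₂' :=
  boxSup_le hlh h0 h0' fun _ _ _ hlu huh ha has hb hbs =>
    le_boxSup hF (hl.trans hlu) (huh.trans hh) ha (has.trans hs) hb (hbs.trans hs')

/-- The lower end of an interval around `t` that is `[0, t]` for `t ∈ [0, 1/3]` and `[t, 1]`
for `t ∈ [2/3, 1]`. -/
noncomputable def lowerEnd (t : ℝ) : ℝ := max 0 (min t (2 * t - 2 / 3))

/-- The upper end of an interval around `t` that is `[0, t]` for `t ∈ [0, 1/3]` and `[t, 1]`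
for `t ∈ [2/3, 1]`. -/
noncomputable def upperEnd (t : ℝ) : ℝ := min 1 (max t (2 * t - 1 / 3))

theorem continuous_lowerEnd : Continuous lowerEnd := by
  unfold lowerEnd
  fun_prop

theorem continuous_upperEnd : Continuous upperEnd := by
  unfold upperEnd
  fun_prop

theorem lowerEnd_le {t : ℝ} (ht : 0 ≤ t) : lowerEnd t ≤ t := max_le ht (min_le_left _ _)

theorem le_upperEnd {t : ℝ} (ht : t ≤ 1) : t ≤ upperEnd t := le_min ht (le_max_left _ _)

theorem lowerEnd_of_le {t : ℝ} (ht : t ≤ 1 / 3) : lowerEnd t = 0 :=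
  max_eq_left ((min_le_right _ _).trans (by linarith))

theorem upperEnd_of_le {t : ℝ} (ht : t ≤ 1 / 3) : upperEnd t = t := by
  rw [upperEnd, max_eq_left (by linarith), min_eq_right (by linarith)]

theorem lowerEnd_of_ge {t : ℝ} (ht : 2 / 3 ≤ t) : lowerEnd t = t := by
  rw [lowerEnd, min_eq_left (by linarith), max_eq_right (by linarith)]

theorem upperEnd_of_ge {t : ℝ} (ht : 2 / 3 ≤ t) : upperEnd t = 1 :=
  min_eq_left ((show (1:ℝ) ≤ 2 * t - 1 / 3 by linarith).trans (le_max_right _ _))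

/-- A function continuous on `[0,1] × [0,∞) × [0,∞)` extends continuously to `ℝ³`. -/
theorem exists_continuous_extension {A : ℝ → ℝ → ℝ → ℝ}
    (hcont : ContinuousOn (fun p : ℝ × ℝ × ℝ => A p.1 p.2.1 p.2.2)
      (Icc (0:ℝ) 1 ×ˢ Ici (0:ℝ) ×ˢ Ici (0:ℝ))) :
    ∃ F : ℝ → ℝ → ℝ → ℝ, (Continuous fun p : ℝ × ℝ × ℝ => F p.1 p.2.1 p.2.2) ∧
      ∀ t s s', 0 ≤ t → t ≤ 1 → 0 ≤ s → 0 ≤ s' → F t s s' = A t s s' := by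
  refine ⟨fun t s s' => A (max 0 (min 1 t)) (max 0 s) (max 0 s'), ?_, ?_⟩
  · exact hcont.comp_continuous (f := fun p : ℝ × ℝ × ℝ =>
      (max 0 (min 1 p.1), max 0 p.2.1, max 0 p.2.2)) (by fun_prop) fun p =>
      ⟨⟨le_max_left _ _, max_le zero_le_one (min_le_left _ _)⟩, mem_Ici.2 (le_max_left _ _),
        mem_Ici.2 (le_max_left _ _)⟩
  · intro t s s' h0 h1 hs hs'
    simp only [min_eq_right h1, max_eq_right h0, max_eq_right hs, max_eq_right hs']

/-- Any continuous `A : [0,1] × [0,∞) × [0,∞) → [0,∞)` with `A(1,s,0) = A(0,0,s) = 0` can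
be replaced by a pointwise larger continuous `A'` with the same boundary vanishing which
is monotonically increasing in its second and third arguments and, in its first argument,
monotonically increasing on `[0,1/3]` and monotonically decreasing on `[2/3,1]`; in
particular every `A`-convex bicombing is `A'`-convex. -/
theorem exists_monotone_majorant {A : ℝ → ℝ → ℝ → ℝ}
    (hcont : ContinuousOn (fun p : ℝ × ℝ × ℝ => A p.1 p.2.1 p.2.2)
      (Set.Icc (0:ℝ) 1 ×ˢ Set.Ici (0:ℝ) ×ˢ Set.Ici (0:ℝ)))
    (hnonneg : ∀ t s s', 0 ≤ t → t ≤ 1 → 0 ≤ s → 0 ≤ s' → 0 ≤ A t s s')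
    (h10 : ∀ s, 0 ≤ s → A 1 s 0 = 0) (h00 : ∀ s, 0 ≤ s → A 0 0 s = 0) :
    ∃ A' : ℝ → ℝ → ℝ → ℝ,
      ContinuousOn (fun p : ℝ × ℝ × ℝ => A' p.1 p.2.1 p.2.2)
        (Set.Icc (0:ℝ) 1 ×ˢ Set.Ici (0:ℝ) ×ˢ Set.Ici (0:ℝ)) ∧
      (∀ t s s', 0 ≤ t → t ≤ 1 → 0 ≤ s → 0 ≤ s' →
        0 ≤ A' t s s' ∧ A t s s' ≤ A' t s s') ∧
      (∀ s, 0 ≤ s → A' 1 s 0 = 0) ∧ (∀ s, 0 ≤ s → A' 0 0 s = 0) ∧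
      MonotoneConvexityFun A' ∧
      ∀ (Y : Type u) [MetricSpace Y] (B : ConstSpeedBicombing Y),
        BicombingAConvex B A → BicombingAConvex B A' := by
  obtain ⟨F, hF, hFA⟩ := exists_continuous_extension hcont
  have hle : ∀ t, 0 ≤ t → t ≤ 1 → lowerEnd t ≤ upperEnd t := fun t h0 h1 =>
    (lowerEnd_le h0).trans (le_upperEnd h1)
  have hmaj : ∀ t s s', 0 ≤ t → t ≤ 1 → 0 ≤ s → 0 ≤ s' →
      A t s s' ≤ boxSup F (lowerEnd t) (upperEnd t) s s' := by
    intro t s s' h0 h1 hs hs'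
    rw [← hFA t s s' h0 h1 hs hs']
    exact le_boxSup hF (lowerEnd_le h0) (le_upperEnd h1) hs le_rfl hs' le_rfl
  refine ⟨fun t s s' => boxSup F (lowerEnd t) (upperEnd t) s s', ?_, ?_, ?_, ?_,
    ⟨?_, ?_, ?_, ?_⟩, ?_⟩
  · have hl := continuous_lowerEnd
    have hu := continuous_upperEnd
    exact ((continuous_boxSup hF).comp (f := fun p : ℝ × ℝ × ℝ =>
      (lowerEnd p.1, upperEnd p.1, p.2.1, p.2.2)) (by fun_prop)).continuousOn
  · exact fun t s s' h0 h1 hs hs' =>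
      ⟨(hnonneg t s s' h0 h1 hs hs').trans (hmaj t s s' h0 h1 hs hs'),
        hmaj t s s' h0 h1 hs hs'⟩
  · intro s hs
    refine le_antisymm ?_ ((hnonneg 1 s 0 zero_le_one le_rfl hs le_rfl).trans
      (hmaj 1 s 0 zero_le_one le_rfl hs le_rfl))
    refine boxSup_le (hle 1 zero_le_one le_rfl) hs le_rfl fun u a b hlu huh ha _ hb hb0 => ?_
    rw [lowerEnd_of_ge (by norm_num)] at hlu
    rw [upperEnd_of_ge (by norm_num)] at huh
    obtain rfl := le_antisymm huh hlu
    obtain rfl := le_antisymm hb0 hb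
    rw [hFA _ _ _ zero_le_one le_rfl ha le_rfl, h10 a ha]
  · intro s hs
    refine le_antisymm ?_ ((hnonneg 0 0 s le_rfl zero_le_one le_rfl hs).trans
      (hmaj 0 0 s le_rfl zero_le_one le_rfl hs))
    refine boxSup_le (hle 0 le_rfl zero_le_one) le_rfl hs fun u a b hlu huh ha ha0 hb _ => ?_
    rw [lowerEnd_of_le (by norm_num)] at hlu
    rw [upperEnd_of_le (by norm_num)] at huh
    obtain rfl := le_antisymm huh hlu
    obtain rfl := le_antisymm ha0 ha
    rw [hFA _ _ _ le_rfl zero_le_one le_rfl hb, h00 b hb]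
  · exact fun t s₁ s₂ s' h0 h1 hs h12 hs' =>
      boxSup_mono hF (hle t h0 h1) hs hs' le_rfl le_rfl h12 le_rfl
  · exact fun t s s₁ s₂ h0 h1 hs hs₁ h12 =>
      boxSup_mono hF (hle t h0 h1) hs hs₁ le_rfl le_rfl le_rfl h12
  · intro t₁ t₂ s s' h0 h12 h2 hs hs'
    refine boxSup_mono hF (hle t₁ h0 (by linarith)) hs hs' ?_ ?_ le_rfl le_rfl
    · rw [lowerEnd_of_le h2, lowerEnd_of_le (h12.trans h2)]
    · rwa [upperEnd_of_le h2, upperEnd_of_le (h12.trans h2)]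
  · intro t₁ t₂ s s' h1 h12 h2 hs hs'
    refine boxSup_mono hF (hle t₂ (by linarith) h2) hs hs' ?_ ?_ le_rfl le_rfl
    · rwa [lowerEnd_of_ge h1, lowerEnd_of_ge (h1.trans h12)]
    · rw [upperEnd_of_ge h1, upperEnd_of_ge (h1.trans h12)]
  · exact fun Y _ B hB x x' y y' t h0 h1 =>
      (hB x x' y y' t h0 h1).trans (hmaj t _ _ h0 h1 dist_nonneg dist_nonneg)

end FJ
end

section
/- Let X be a metric space, γ a constant-speed bicombing on X, and suppose there is a continuous function f : [0,∞) → [0,∞) with f(0) = 0 such that |l(γ_{x,y}) − l(γ_{x',y'})| ≤ f(d(x,x') + d(y,y')) for all x,x',y,y' ∈ X. Then the map X × X × ℝ → Lip₁(X), (x,y,t) ↦ Φ_t c_{x,y}, is continuous (with respect to the metric D on Lip₁(X)). -/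
open MeasureTheory Set

namespace FJ

namespace ConstSpeedBicombing

variable {X : Type*} [MetricSpace X] (B : ConstSpeedBicombing X)

theorem dist_source_le (x y : X) {s : ℝ} (hs : s ∈ Icc (0:ℝ) 1) :
    dist x (B.toFun x y s) ≤ B.len x y := by
  have h := eVariationOn.edist_le (B.toFun x y) (left_mem_Icc.2 zero_le_one) hs
  rw [B.speed x y 0 1 le_rfl zero_le_one le_rfl, B.source, sub_zero, mul_one, edist_dist] at h
  exact (ENNReal.ofReal_le_ofReal_iff (B.len_nonneg x y)).1 h

theorem exists_trail_eq (x y : X) (t : ℝ) :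
    ∃ s ∈ Icc (0:ℝ) 1, trail B x y t = B.toFun x y s := by
  unfold trail
  split_ifs with h₀ h₁
  · exact ⟨0, left_mem_Icc.2 zero_le_one, (B.source x y).symm⟩
  · have hL : 0 < B.len x y := (not_le.1 h₀).trans h₁
    exact ⟨_, ⟨div_nonneg (not_le.1 h₀).le hL.le, (div_le_one hL).2 h₁.le⟩, rfl⟩
  · exact ⟨1, right_mem_Icc.2 zero_le_one, (B.target x y).symm⟩

theorem dist_trail_le (x y : X) (t : ℝ) : dist x (trail B x y t) ≤ B.len x y := by
  obtain ⟨s, hs, h⟩ := B.exists_trail_eq x y t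
  exact h ▸ B.dist_source_le x y hs

theorem trail_eq_projIcc {x y : X} (hL : 0 < B.len x y) (t : ℝ) :
    trail B x y t = B.toFun x y (projIcc (0:ℝ) 1 zero_le_one (t / B.len x y)) := by
  unfold trail
  split_ifs with h₀ h₁
  · rw [projIcc_of_le_left _ (div_nonpos_of_nonpos_of_nonneg h₀ hL.le), B.source]
  · rw [projIcc_of_mem _ ⟨div_nonneg (not_le.1 h₀).le hL.le, (div_le_one hL).2 h₁.le⟩]
  · rw [projIcc_of_right_le _ ((one_le_div hL).2 (not_lt.1 h₁)), B.target]

theorem continuous_len {f : ℝ → ℝ} (hfc : ContinuousOn f (Ici 0)) (hf0 : f 0 = 0)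
    (hlen : ∀ x x' y y' : X, |B.len x y - B.len x' y'| ≤ f (dist x x' + dist y y')) :
    Continuous fun p : X × X => B.len p.1 p.2 := by
  rw [continuous_iff_continuousAt]
  rintro ⟨x, y⟩
  have hd : Continuous fun p : X × X => dist p.1 x + dist p.2 y := by fun_prop
  have hg : Continuous fun p : X × X => f (dist p.1 x + dist p.2 y) :=
    hfc.comp_continuous hd fun p => add_nonneg dist_nonneg dist_nonneg
  have h0 := hg.tendsto (x, y)
  simp only [dist_self, add_zero, hf0] at h0
  rw [ContinuousAt, tendsto_iff_dist_tendsto_zero]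
  exact squeeze_zero (fun _ => dist_nonneg) (fun p => hlen p.1 x p.2 y) h0

theorem continuous_trail (hlen : Continuous fun p : X × X => B.len p.1 p.2) :
    Continuous fun p : X × X × ℝ => trail B p.1 p.2.1 p.2.2 := by
  have hl : Continuous fun p : X × X × ℝ => B.len p.1 p.2.1 :=
    hlen.comp (by fun_prop : Continuous fun p : X × X × ℝ => (p.1, p.2.1))
  rw [continuous_iff_continuousAt]
  rintro ⟨x, y, t⟩
  rcases (B.len_nonneg x y).eq_or_lt with hL | hL
  · have hx : trail B x y t = x :=
      (dist_le_zero.1 ((B.dist_trail_le x y t).trans hL.ge)).symm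
    have h0 : Filter.Tendsto (fun p : X × X × ℝ => B.len p.1 p.2.1 + dist p.1 x)
        (nhds (x, y, t)) (nhds 0) := by
      have hsum : Continuous fun p : X × X × ℝ => B.len p.1 p.2.1 + dist p.1 x :=
        hl.add (by fun_prop)
      simpa [← hL] using hsum.tendsto (x, y, t)
    rw [ContinuousAt, tendsto_iff_dist_tendsto_zero]
    refine squeeze_zero (fun _ => dist_nonneg) (fun p => ?_) h0
    simp only [hx]
    calc dist (trail B p.1 p.2.1 p.2.2) x
        ≤ dist (trail B p.1 p.2.1 p.2.2) p.1 + dist p.1 x := dist_triangle _ _ _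
      _ ≤ B.len p.1 p.2.1 + dist p.1 x := by
        gcongr
        rw [dist_comm]
        exact B.dist_trail_le _ _ _
  · have hev : ∀ᶠ p : X × X × ℝ in nhds (x, y, t), 0 < B.len p.1 p.2.1 :=
      hl.continuousAt.eventually (lt_mem_nhds hL)
    have hγ : Continuous fun p : X × X × Icc (0:ℝ) 1 => B.toFun p.1 p.2.1 p.2.2 :=
      B.continuousOn.comp_continuous
        (by fun_prop : Continuous fun p : X × X × Icc (0:ℝ) 1 => (p.1, p.2.1, (p.2.2 : ℝ)))
        fun p => ⟨mem_univ _, mem_univ _, p.2.2.2⟩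
    have hdiv : ContinuousAt (fun p : X × X × ℝ => p.2.2 / B.len p.1 p.2.1) (x, y, t) :=
      ContinuousAt.div (by fun_prop) hl.continuousAt hL.ne'
    have hproj : ContinuousAt (fun p : X × X × ℝ =>
        projIcc (0:ℝ) 1 zero_le_one (p.2.2 / B.len p.1 p.2.1)) (x, y, t) :=
      continuous_projIcc.continuousAt.comp hdiv
    have hpair : ContinuousAt (fun p : X × X × ℝ =>
        (p.1, p.2.1, projIcc (0:ℝ) 1 zero_le_one (p.2.2 / B.len p.1 p.2.1))) (x, y, t) :=
      ContinuousAt.prodMk (by fun_prop) (ContinuousAt.prodMk (by fun_prop) hproj)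
    refine (ContinuousAt.comp (f := fun p : X × X × ℝ =>
        (p.1, p.2.1, projIcc (0:ℝ) 1 zero_le_one (p.2.2 / B.len p.1 p.2.1)))
        hγ.continuousAt hpair).congr ?_
    filter_upwards [hev] with p hp
    exact (B.trail_eq_projIcc hp _).symm

end ConstSpeedBicombing

theorem integrable_div_two_mul_exp_abs (C : ℝ) :
    Integrable fun t : ℝ => C / (2 * Real.exp |t|) := by
  have h : Integrable fun t : ℝ => Real.exp (-|t|) := by
    rw [← integrableOn_univ, ← Iic_union_Ioi (a := (0:ℝ)), integrableOn_union]
    constructor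
    · refine (integrableOn_exp_Iic 0).congr_fun (fun t ht => ?_) measurableSet_Iic
      simp [abs_of_nonpos (mem_Iic.1 ht)]
    · refine (integrableOn_exp_neg_Ioi 0).congr_fun (fun t ht => ?_) measurableSet_Ioi
      simp [abs_of_pos (mem_Ioi.1 ht)]
  refine (h.const_mul (C / 2)).congr (.of_forall fun t => ?_)
  simp only [Real.exp_neg]
  field_simp

/-- If there is a continuous `f : [0,∞) → [0,∞)` with `f(0) = 0` controlling the path
lengths, `|l(γ_{x,y}) − l(γ_{x',y'})| ≤ f(d(x,x') + d(y,y'))`, then the map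
`X × X × ℝ → Lip₁(X)`, `(x,y,τ) ↦ Φ_τ c_{x,y}`, is continuous with respect to the
metric `D` on `Lip₁(X)`. -/
theorem trail_map_continuous {X : Type*} [MetricSpace X] (B : ConstSpeedBicombing X)
    (f : ℝ → ℝ) (hfc : ContinuousOn f (Set.Ici 0)) (hf0 : f 0 = 0)
    (hfnn : ∀ s, 0 ≤ s → 0 ≤ f s)
    (hlen : ∀ x x' y y' : X, |B.len x y - B.len x' y'| ≤ f (dist x x' + dist y y')) :
    ∀ (x y : X) (τ : ℝ), ∀ ε > (0:ℝ), ∃ δ > (0:ℝ), ∀ (x' y' : X) (τ' : ℝ),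
      dist x x' < δ → dist y y' < δ → |τ' - τ| < δ →
      lipDist (timeShift τ (trail B x y)) (timeShift τ' (trail B x' y')) < ε := by
  intro x y τ ε hε
  have hl := B.continuous_len hfc hf0 hlen
  have hc := B.continuous_trail hl
  have htend : Filter.Tendsto (fun p : X × X × ℝ =>
      lipDist (timeShift τ (trail B x y)) (timeShift p.2.2 (trail B p.1 p.2.1)))
      (nhds (x, y, τ)) (nhds 0) := by
    have hbase : Continuous fun t : ℝ => trail B x y (t + τ) :=
      hc.comp (by fun_prop : Continuous fun t : ℝ => (x, y, t + τ))
    have hnear : ∀ᶠ p : X × X × ℝ in nhds (x, y, τ),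
        B.len x y + dist x p.1 + B.len p.1 p.2.1 < 2 * B.len x y + 1 := by
      have hcont : Continuous fun p : X × X × ℝ => B.len x y + dist x p.1 + B.len p.1 p.2.1 :=
        (by fun_prop : Continuous fun p : X × X × ℝ => B.len x y + dist x p.1).add
          (hl.comp (by fun_prop : Continuous fun p : X × X × ℝ => (p.1, p.2.1)))
      refine hcont.continuousAt.eventually (gt_mem_nhds ?_)
      simp only [dist_self]
      linarith
    have key := tendsto_integral_filter_of_dominated_convergence (μ := volume)
      (l := nhds (x, y, τ)) (f := fun _ : ℝ => (0:ℝ))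
      (F := fun (p : X × X × ℝ) (t : ℝ) =>
        dist (trail B x y (t + τ)) (trail B p.1 p.2.1 (t + p.2.2)) / (2 * Real.exp |t|))
      (fun t => (2 * B.len x y + 1) / (2 * Real.exp |t|)) ?_ ?_
      (integrable_div_two_mul_exp_abs _) ?_
    · simpa [lipDist, timeShift] using key
    · refine .of_forall fun p => Continuous.aestronglyMeasurable ?_
      have hp : Continuous fun t : ℝ => trail B p.1 p.2.1 (t + p.2.2) :=
        hc.comp (by fun_prop : Continuous fun t : ℝ => (p.1, p.2.1, t + p.2.2))
      exact (hbase.dist hp).div (by fun_prop) fun t => by positivity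
    · filter_upwards [hnear] with p hp
      refine .of_forall fun t => ?_
      rw [Real.norm_of_nonneg (by positivity)]
      gcongr
      have h₁ := B.dist_trail_le x y (t + τ)
      have h₂ := B.dist_trail_le p.1 p.2.1 (t + p.2.2)
      have h₃ := dist_triangle4 (trail B x y (t + τ)) x p.1 (trail B p.1 p.2.1 (t + p.2.2))
      rw [dist_comm _ x] at h₃
      linarith
    · refine .of_forall fun t => ?_
      have hp : Continuous fun p : X × X × ℝ => trail B p.1 p.2.1 (t + p.2.2) :=
        hc.comp (by fun_prop : Continuous fun p : X × X × ℝ => (p.1, p.2.1, t + p.2.2))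
      have := ((continuous_const (y := trail B x y (t + τ))).dist hp).div_const (2 * Real.exp |t|)
      simpa using this.tendsto (x, y, τ)
  obtain ⟨δ, hδ, h⟩ := Metric.eventually_nhds_iff.1 (htend.eventually (gt_mem_nhds hε))
  refine ⟨δ, hδ, fun x' y' τ' hx hy hτ => h (y := (x', y', τ')) ?_⟩
  simp only [Prod.dist_eq, max_lt_iff]
  exact ⟨dist_comm x x' ▸ hx, dist_comm y y' ▸ hy, by rwa [Real.dist_eq]⟩
end FJ
end

section
/- Let X be a metric space, γ a constant-speed bicombing on X, and suppose there is a continuous function f : [0,∞) → [0,∞) with f(0) = 0 such that |l(γ_{x,y}) − l(γ_{x',y'})| ≤ f(d(x,x') + d(y,y')) for all x,x',y,y' ∈ X. Then for every a ≤ b in ℝ the subset A(X,γ,[a,b]) is closed in Lip₁(X). -/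
open MeasureTheory Set

namespace FJ

theorem ConstSpeedBicombing.dist_source_le_len {X : Type*} [MetricSpace X]
    (B : ConstSpeedBicombing X) (x y : X) {t : ℝ} (ht : t ∈ Icc (0 : ℝ) 1) :
    dist (B.toFun x y t) x ≤ B.len x y := by
  have h1 := eVariationOn.edist_le (B.toFun x y) (s := Icc 0 1) ht
    (left_mem_Icc.2 zero_le_one)
  rw [B.speed x y 0 1 le_rfl zero_le_one le_rfl, B.source, edist_dist,
    ENNReal.ofReal_le_ofReal_iff (by simpa using B.len_nonneg x y)] at h1
  simpa using h1

/-- A path of positive length is not constant on any nondegenerate subinterval. -/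
theorem ConstSpeedBicombing.len_eq_zero_of_const {X : Type*} [MetricSpace X]
    (B : ConstSpeedBicombing X) {x y z : X} {s t : ℝ} (hs : 0 ≤ s) (hst : s < t) (ht : t ≤ 1)
    (h : ∀ r ∈ Icc s t, B.toFun x y r = z) : B.len x y = 0 := by
  have h1 := B.speed x y s t hs hst.le ht
  have h0 : eVariationOn (B.toFun x y) (Icc s t) = 0 :=
    eVariationOn.constant_on (by
      rintro _ ⟨p, hp, rfl⟩ _ ⟨q, hq, rfl⟩
      rw [h p hp, h q hq])
  rw [h0] at h1
  have h2 := ENNReal.ofReal_eq_zero.1 h1.symm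
  have h3 := B.len_nonneg x y
  nlinarith [sub_pos.2 hst]

theorem ConstSpeedBicombing.continuous_clamped {X : Type*} [MetricSpace X]
    (B : ConstSpeedBicombing X) :
    Continuous fun p : X × X × ℝ => B.toFun p.1 p.2.1 (max 0 (min 1 p.2.2)) := by
  have hg : Continuous fun p : X × X × ℝ => (p.1, p.2.1, max 0 (min 1 p.2.2)) := by fun_prop
  exact B.continuousOn.comp_continuous hg fun p => by simp

theorem trail_of_len_pos {X : Type*} [MetricSpace X] (B : ConstSpeedBicombing X) {x y : X}
    (h : 0 < B.len x y) (t : ℝ) :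
    trail B x y t = B.toFun x y (max 0 (min 1 (t / B.len x y))) := by
  unfold trail
  split_ifs with h0 h1
  · have : t / B.len x y ≤ 0 := div_nonpos_of_nonpos_of_nonneg h0 h.le
    rw [min_eq_right (this.trans zero_le_one), max_eq_left this, B.source]
  · have h2 : t / B.len x y ≤ 1 := ((div_lt_one h).2 h1).le
    rw [min_eq_right h2, max_eq_right (div_nonneg (not_le.1 h0).le h.le)]
  · have h2 : 1 ≤ t / B.len x y := (one_le_div h).2 (not_lt.1 h1)
    rw [min_eq_left h2, max_eq_right zero_le_one, B.target]

theorem trail_of_len_eq_zero {X : Type*} [MetricSpace X] (B : ConstSpeedBicombing X) {x y : X}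
    (h : B.len x y = 0) (t : ℝ) : trail B x y t = x := by
  have hxy := B.eq_of_len_eq_zero h
  unfold trail
  split_ifs with h0 h1
  · rfl
  · linarith
  · exact hxy.symm

theorem dist_trail_source_le_len {X : Type*} [MetricSpace X] (B : ConstSpeedBicombing X)
    (x y : X) (t : ℝ) : dist (trail B x y t) x ≤ B.len x y := by
  rcases (B.len_nonneg x y).eq_or_lt' with h | h
  · rw [trail_of_len_eq_zero B h, h, dist_self]
  · rw [trail_of_len_pos B h]
    exact B.dist_source_le_len x y (by simp)

/-- A trail of positive length is not constant on any interval `(-∞, c]` with `c > 0`. -/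
theorem len_eq_zero_of_trail_const_left {X : Type*} [MetricSpace X]
    (B : ConstSpeedBicombing X) {x y z : X} {c : ℝ} (hc : 0 < c)
    (h : ∀ t ≤ c, trail B x y t = z) : B.len x y = 0 := by
  by_contra hne
  have hpos : 0 < B.len x y := (B.len_nonneg x y).lt_of_ne' hne
  refine hne (B.len_eq_zero_of_const (z := z) le_rfl
    (lt_min one_pos (div_pos hc hpos)) (min_le_left _ _) fun r hr => ?_)
  have h1 := h (r * B.len x y) ((le_div_iff₀ hpos).1 (hr.2.trans (min_le_right _ _)))
  rwa [trail_of_len_pos B hpos, mul_div_cancel_right₀ _ hne,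
    min_eq_right (hr.2.trans (min_le_left _ _)), max_eq_right hr.1] at h1

/-- A trail of positive length `l` is not constant on any interval `[c, ∞)` with `c < l`. -/
theorem len_eq_zero_of_trail_const_right {X : Type*} [MetricSpace X]
    (B : ConstSpeedBicombing X) {x y z : X} {c : ℝ} (hc : c < B.len x y)
    (h : ∀ t, c ≤ t → trail B x y t = z) : B.len x y = 0 := by
  by_contra hne
  have hpos : 0 < B.len x y := (B.len_nonneg x y).lt_of_ne' hne
  refine hne (B.len_eq_zero_of_const (z := z) (le_max_left 0 (c / B.len x y))
    (max_lt one_pos ((div_lt_one hpos).2 hc)) le_rfl fun r hr => ?_)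
  have h1 := h (r * B.len x y) ((div_le_iff₀ hpos).1 ((le_max_right _ _).trans hr.1))
  rwa [trail_of_len_pos B hpos, mul_div_cancel_right₀ _ hne,
    min_eq_right hr.2, max_eq_right ((le_max_left _ _).trans hr.1)] at h1

/-- An element of `A(X,γ,[a,b])` is the trail between its values at `a` and `b`, shifted by
some `τ ∈ [-b,-a]`. -/
theorem exists_shift_of_mem_aIntSet {X : Type*} [MetricSpace X] (B : ConstSpeedBicombing X)
    {a b : ℝ} (hab : a ≤ b) {w : C(ℝ, X)} (hw : w ∈ AIntSet B a b) :
    ∃ τ ∈ Icc (-b) (-a), ∀ s, w s = trail B (w a) (w b) (s + τ) := by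
  obtain ⟨⟨x, y, τ, hτ⟩, ha, hb⟩ := hw
  have hxa : w a = x := by
    rw [← ha (min a (-τ)) (min_le_left _ _), hτ, trail,
      if_pos (by linarith [min_le_right a (-τ)])]
  rcases (B.len_nonneg x y).eq_or_lt' with h | h
  · have hconst : ∀ s, w s = x := fun s => by rw [hτ, trail_of_len_eq_zero B h]
    refine ⟨-a, ⟨neg_le_neg hab, le_rfl⟩, fun s => ?_⟩
    rw [hconst, hconst, hconst, trail_of_len_eq_zero B]
    rwa [← B.eq_of_len_eq_zero h] at h
  · have hyb : w b = y := by
      have h1 := le_max_right b (B.len x y - τ)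
      rw [← hb (max b (B.len x y - τ)) (le_max_left _ _), hτ, trail,
        if_neg (by linarith), if_neg (by linarith)]
    refine ⟨τ, ⟨?_, ?_⟩, by rwa [hxa, hyb]⟩
    · by_contra! hlt
      refine h.ne' (len_eq_zero_of_trail_const_right B (z := w b) (c := b + τ)
        (by linarith) fun t ht => ?_)
      rw [← hb (t - τ) (by linarith), hτ, sub_add_cancel]
    · by_contra! hlt
      refine h.ne' (len_eq_zero_of_trail_const_left B (z := w a) (c := a + τ)
        (by linarith) fun t ht => ?_)
      rw [← ha (t - τ) (by linarith), hτ, sub_add_cancel]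

theorem continuous_len {X : Type*} [MetricSpace X] (B : ConstSpeedBicombing X)
    {f : ℝ → ℝ} (hfc : ContinuousOn f (Ici 0)) (hf0 : f 0 = 0)
    (hlen : ∀ x x' y y' : X, |B.len x y - B.len x' y'| ≤ f (dist x x' + dist y y')) :
    Continuous fun p : X × X => B.len p.1 p.2 := by
  refine continuous_iff_continuousAt.2 fun p => tendsto_iff_dist_tendsto_zero.2 ?_
  have hg : Continuous fun q : X × X => f (dist q.1 p.1 + dist q.2 p.2) :=
    hfc.comp_continuous (by fun_prop) fun q => add_nonneg dist_nonneg dist_nonneg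
  have h0 := hg.tendsto p
  simp only [dist_self, add_zero, hf0] at h0
  exact squeeze_zero (fun _ => dist_nonneg) (fun q => hlen q.1 p.1 q.2 p.2) h0

/-- If there is a continuous `f : [0,∞) → [0,∞)` with `f(0) = 0` and
`|l(γ_{x,y}) − l(γ_{x',y'})| ≤ f(d(x,x') + d(y,y'))`, then for all `a ≤ b` the subset
`A(X,γ,[a,b])` is closed in `Lip₁(X)` (whose topology, induced by the metric `D`, is the
subspace topology from the compact-open topology on `C(ℝ,X)`). -/
theorem aIntSet_isClosed {X : Type*} [MetricSpace X] (B : ConstSpeedBicombing X)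
    (f : ℝ → ℝ) (hfc : ContinuousOn f (Set.Ici 0)) (hf0 : f 0 = 0)
    (hfnn : ∀ s, 0 ≤ s → 0 ≤ f s)
    (hlen : ∀ x x' y y' : X, |B.len x y - B.len x' y'| ≤ f (dist x x' + dist y y'))
    (a b : ℝ) (hab : a ≤ b) :
    IsClosed {w : {w : C(ℝ, X) // LipschitzWith 1 ⇑w} | w.1 ∈ AIntSet B a b} := by
  have hev : ∀ s : ℝ, Continuous fun v : {w : C(ℝ, X) // LipschitzWith 1 ⇑w} => v.1 s :=
    fun s => (continuous_eval_const (F := C(ℝ, X)) s).comp continuous_subtype_val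
  refine isClosed_iff_ultrafilter.2 fun w u hu hS => ?_
  have hpt : ∀ s : ℝ, Filter.Tendsto
      (fun v : {w : C(ℝ, X) // LipschitzWith 1 ⇑w} => v.1 s) u (nhds (w.1 s)) :=
    fun s => ((hev s).tendsto w).mono_left hu
  have hwa : ∀ s, s ≤ a → w.1 s = w.1 a := fun s hs =>
    tendsto_nhds_unique_of_eventuallyEq (hpt s) (hpt a)
      (Filter.mem_of_superset hS fun v hv => hv.2.1 s hs)
  have hwb : ∀ s, b ≤ s → w.1 s = w.1 b := fun s hs =>
    tendsto_nhds_unique_of_eventuallyEq (hpt s) (hpt b)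
      (Filter.mem_of_superset hS fun v hv => hv.2.2 s hs)
  refine ⟨?_, hwa, hwb⟩
  have hlim : Filter.Tendsto
      (fun v : {w : C(ℝ, X) // LipschitzWith 1 ⇑w} => B.len (v.1 a) (v.1 b)) u
      (nhds (B.len (w.1 a) (w.1 b))) :=
    ((continuous_len B hfc hf0 hlen).tendsto (w.1 a, w.1 b)).comp ((hpt a).prodMk_nhds (hpt b))
  have hshift : ∀ v : {w : C(ℝ, X) // LipschitzWith 1 ⇑w}, ∃ τ : ℝ, v.1 ∈ AIntSet B a b →
      τ ∈ Icc (-b) (-a) ∧ ∀ s, v.1 s = trail B (v.1 a) (v.1 b) (s + τ) := fun v => by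
    by_cases hv : v.1 ∈ AIntSet B a b
    · obtain ⟨τ, h⟩ := exists_shift_of_mem_aIntSet B hab hv
      exact ⟨τ, fun _ => h⟩
    · exact ⟨0, fun h => absurd h hv⟩
  choose τ hτ using hshift
  obtain ⟨τ₀, -, hτ₀⟩ := (isCompact_Icc (a := -b) (b := -a)).ultrafilter_le_nhds (u.map τ)
    (Filter.le_principal_iff.2 (Filter.mem_map.2
      (Filter.mem_of_superset hS fun v hv => (hτ v hv).1)))
  have hτlim : Filter.Tendsto τ u (nhds τ₀) := hτ₀
  refine ⟨w.1 a, w.1 b, τ₀, fun s => ?_⟩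
  rcases (B.len_nonneg (w.1 a) (w.1 b)).eq_or_lt' with h | h
  · rw [trail_of_len_eq_zero B h]
    rw [h] at hlim
    refine dist_le_zero.1 (le_of_tendsto_of_tendsto ((hpt s).dist (hpt a)) hlim
      (Filter.mem_of_superset hS fun v hv => ?_))
    have h1 := dist_trail_source_le_len B (v.1 a) (v.1 b) (s + τ v)
    rwa [← (hτ v hv).2 s] at h1
  · rw [trail_of_len_pos B h]
    have hclamp := (B.continuous_clamped.tendsto
      (w.1 a, w.1 b, (s + τ₀) / B.len (w.1 a) (w.1 b))).comp
      ((hpt a).prodMk_nhds ((hpt b).prodMk_nhds ((hτlim.const_add s).div hlim h.ne')))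
    refine tendsto_nhds_unique_of_eventuallyEq (hpt s) hclamp ?_
    filter_upwards [hS, hlim.eventually_const_lt h] with v hv hpos
    exact ((hτ v hv).2 s).trans (trail_of_len_pos B hpos _)
end FJ
end
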